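/- Theorem 1 (hidden-state part): the posterior of the hidden states is again a Markov tree with initial probabilities ρ₀₀(s)φ₀₀(s)/ξ₀₀(0) and transition probabilities ρ_{j,k}(s,s')φ_{j,k}(s')/ξ_{j,k}(s). Precisely, assume ξ_{j,k}(s) ≠ 0 for all (j,k) ∈ T with j ≥ 1 and all s ∈ {0,1}, and ξ₀₀(0) ≠ 0. Then for every assignment σ : T → {0,1}: [ρ₀₀(σ(0,0))·φ₀₀(σ(0,0))/ξ₀₀(0)] · ∏_{j=1}^{J} ∏_{k=0}^{2^j−1} [ρ_{j,k}(σ(j−1,⌊k/2⌋), σ(j,k))·φ_{j,k}(σ(j,k))/ξ_{j,k}(σ(j−1,⌊k/2⌋))] = P(σ)·L(σ)/ξ₀₀(0), where P(σ) = ρ₀₀(σ(0,0)) · ∏_{j=1}^{J} ∏_{k} ρ_{j,k}(σ(j−1,⌊k/2⌋), σ(j,k)) and L(σ) = ∏_{(j,k)∈T} m_{j,k}(σ(j,k)). -/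

import Mathlib

open scoped BigOperators

/-- If `m < 2^(t+1)` then `m / 2 < 2^t`. -/
lemma half_lt {t m : ℕ} (hm : m < 2 ^ (t + 1)) : m / 2 < 2 ^ t :=
  Nat.div_lt_of_lt_mul (by rw [mul_comm]; simpa [pow_succ] using hm)

/-- The bottom-up pyramid recursion `φ_{j,k}(s)`. -/
noncomputable def phi (J : ℕ) (ρ : ℕ → ℕ → Bool → Bool → ℝ)
    (m : ℕ → ℕ → Bool → ℝ) : ℕ → ℕ → Bool → ℝ
  | j, k, s =>
    if h : j < J then
      m j k s
        * (∑ s' : Bool, ρ (j + 1) (2 * k) s s' * phi J ρ m (j + 1) (2 * k) s')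
        * (∑ s' : Bool, ρ (j + 1) (2 * k + 1) s s' * phi J ρ m (j + 1) (2 * k + 1) s')
    else m j k s
  termination_by j _ _ => J - j
  decreasing_by all_goals omega

/-- `ξ_{j,k}(s) = ∑_{s'} ρ_{j,k}(s,s') · φ_{j,k}(s')`, for `j ≥ 1`. -/
noncomputable def xi (J : ℕ) (ρ : ℕ → ℕ → Bool → Bool → ℝ)
    (m : ℕ → ℕ → Bool → ℝ) (j k : ℕ) (s : Bool) : ℝ :=
  ∑ s' : Bool, ρ j k s s' * phi J ρ m j k s'

/-- `ξ₀₀ = ∑_{s'} ρ₀₀(s') · φ₀₀(s')` (independent of the argument `s`). -/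
noncomputable def xiRoot (J : ℕ) (ρ₀ : Bool → ℝ) (ρ : ℕ → ℕ → Bool → Bool → ℝ)
    (m : ℕ → ℕ → Bool → ℝ) : ℝ :=
  ∑ s' : Bool, ρ₀ s' * phi J ρ m 0 0 s'

/-- A product over `range (2 * n)` grouped into consecutive pairs. -/
lemma prod_range_two_mul {M : Type*} [CommMonoid M] (f : ℕ → M) (n : ℕ) :
    ∏ k ∈ Finset.range (2 * n), f k = ∏ k ∈ Finset.range n, f (2 * k) * f (2 * k + 1) := by
  induction n with
  | zero => simp
  | succ n ih =>
    rw [Nat.mul_succ, Finset.prod_range_succ, Finset.prod_range_succ, Finset.prod_range_succ, ih,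
      mul_assoc]

lemma phi_of_lt {J j : ℕ} (h : j < J) (ρ : ℕ → ℕ → Bool → Bool → ℝ) (m : ℕ → ℕ → Bool → ℝ)
    (k : ℕ) (s : Bool) :
    phi J ρ m j k s = m j k s * xi J ρ m (j + 1) (2 * k) s * xi J ρ m (j + 1) (2 * k + 1) s := by
  rw [phi, dif_pos h]
  rfl

lemma phi_self (J : ℕ) (ρ : ℕ → ℕ → Bool → Bool → ℝ) (m : ℕ → ℕ → Bool → ℝ) (k : ℕ) (s : Bool) :
    phi J ρ m J k s = m J k s := by
  rw [phi, dif_neg (lt_irrefl J)]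

/-- The product of `φ` over one level is the product of the likelihoods of that level times the
product of `ξ` over the next level. -/
lemma prod_phi_level {J j : ℕ} (h : j < J) (ρ : ℕ → ℕ → Bool → Bool → ℝ)
    (m : ℕ → ℕ → Bool → ℝ) (s : ℕ → ℕ → Bool) :
    ∏ k ∈ Finset.range (2 ^ j), phi J ρ m j k (s j k)
      = (∏ k ∈ Finset.range (2 ^ j), m j k (s j k))
        * ∏ k ∈ Finset.range (2 ^ (j + 1)), xi J ρ m (j + 1) k (s j (k / 2)) := by
  rw [pow_succ', prod_range_two_mul, ← Finset.prod_mul_distrib]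
  refine Finset.prod_congr rfl fun k _ => ?_
  rw [phi_of_lt h, show 2 * k / 2 = k by omega, show (2 * k + 1) / 2 = k by omega, mul_assoc]

/-- The ratios `φ / ξ` telescope along the levels of the tree. -/
lemma phi_mul_prod_div_xi {J : ℕ} (ρ : ℕ → ℕ → Bool → Bool → ℝ) (m : ℕ → ℕ → Bool → ℝ)
    (hξ : ∀ j k, 1 ≤ j → j ≤ J → k < 2 ^ j → ∀ s : Bool, xi J ρ m j k s ≠ 0)
    (s : ℕ → ℕ → Bool) (n : ℕ) (hn : n ≤ J) :
    phi J ρ m 0 0 (s 0 0)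
        * ∏ t ∈ Finset.range n, ∏ k ∈ Finset.range (2 ^ (t + 1)),
            phi J ρ m (t + 1) k (s (t + 1) k) / xi J ρ m (t + 1) k (s t (k / 2))
      = (∏ t ∈ Finset.range n, ∏ k ∈ Finset.range (2 ^ t), m t k (s t k))
        * ∏ k ∈ Finset.range (2 ^ n), phi J ρ m n k (s n k) := by
  induction n with
  | zero => simp
  | succ n ih =>
    have hX : ∏ k ∈ Finset.range (2 ^ (n + 1)), xi J ρ m (n + 1) k (s n (k / 2)) ≠ 0 :=
      Finset.prod_ne_zero_iff.2 fun k hk =>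
        hξ (n + 1) k (by omega) hn (Finset.mem_range.1 hk) _
    rw [Finset.prod_range_succ, Finset.prod_range_succ, ← mul_assoc, ih (by omega),
      prod_phi_level hn, Finset.prod_div_distrib]
    field_simp

/-- Theorem 1, hidden-state part: the posterior of the hidden states is a Markov
tree with initial probabilities `ρ₀₀(s)φ₀₀(s)/ξ₀₀(0)` and transition probabilities
`ρ_{j,k}(s,s')φ_{j,k}(s')/ξ_{j,k}(s)`.  Assuming `ξ_{j,k}(s) ≠ 0` for all tree nodes with
`j ≥ 1` and all `s ∈ {0,1}`, and `ξ₀₀(0) ≠ 0`, the product of those posterior initial and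
transition probabilities along any assignment `σ` of the full tree equals
`P(σ)·L(σ)/ξ₀₀(0)`. -/
theorem stmt3 (J : ℕ) (ρ₀ : Bool → ℝ) (ρ : ℕ → ℕ → Bool → Bool → ℝ)
    (m : ℕ → ℕ → Bool → ℝ)
    (hξ : ∀ j k, 1 ≤ j → j ≤ J → k < 2 ^ j → ∀ s : Bool, xi J ρ m j k s ≠ 0)
    (hξ0 : xiRoot J ρ₀ ρ m ≠ 0)
    (σ : (t : Fin (J + 1)) → Fin (2 ^ (t : ℕ)) → Bool) :
    (ρ₀ (σ ⟨0, by omega⟩ ⟨0, by positivity⟩)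
          * phi J ρ m 0 0 (σ ⟨0, by omega⟩ ⟨0, by positivity⟩) / xiRoot J ρ₀ ρ m)
        * ∏ t : Fin J, ∏ kk : Fin (2 ^ ((t : ℕ) + 1)),
            (ρ ((t : ℕ) + 1) (kk : ℕ)
                (σ ⟨(t : ℕ), by have := t.isLt; omega⟩ ⟨(kk : ℕ) / 2, half_lt kk.isLt⟩)
                (σ ⟨(t : ℕ) + 1, by have := t.isLt; omega⟩ kk)
              * phi J ρ m ((t : ℕ) + 1) (kk : ℕ)
                  (σ ⟨(t : ℕ) + 1, by have := t.isLt; omega⟩ kk)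
              / xi J ρ m ((t : ℕ) + 1) (kk : ℕ)
                  (σ ⟨(t : ℕ), by have := t.isLt; omega⟩ ⟨(kk : ℕ) / 2, half_lt kk.isLt⟩))
    = (ρ₀ (σ ⟨0, by omega⟩ ⟨0, by positivity⟩)
          * ∏ t : Fin J, ∏ kk : Fin (2 ^ ((t : ℕ) + 1)),
              ρ ((t : ℕ) + 1) (kk : ℕ)
                (σ ⟨(t : ℕ), by have := t.isLt; omega⟩ ⟨(kk : ℕ) / 2, half_lt kk.isLt⟩)
                (σ ⟨(t : ℕ) + 1, by have := t.isLt; omega⟩ kk))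
        * (∏ t : Fin (J + 1), ∏ kk : Fin (2 ^ (t : ℕ)), m (t : ℕ) (kk : ℕ) (σ t kk))
        / xiRoot J ρ₀ ρ m := by
  obtain ⟨s, hs⟩ : ∃ s : ℕ → ℕ → Bool, ∀ t k, σ t k = s t k :=
    ⟨fun j k => if h : ∃ _ : j < J + 1, k < 2 ^ j then σ ⟨j, h.1⟩ ⟨k, h.2⟩ else false,
      fun t k => by dsimp only; rw [dif_pos ⟨t.isLt, k.isLt⟩]⟩
  have key := phi_mul_prod_div_xi ρ m hξ s J le_rfl
  simp only [phi_self] at key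
  rw [← Finset.prod_range_succ (fun t => ∏ k ∈ Finset.range (2 ^ t), m t k (s t k))] at key
  simp only [Finset.prod_range] at key
  simp only [hs, mul_div_assoc, Finset.prod_mul_distrib]
  rw [← key]
  ring
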